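/- Fix n ≥ 2 and q ∈ ℂ. Let V be the complex vector space of finitely supported functions (Fin (n−1) → ℕ) → ℂ, and for 1 ≤ i ≤ n−1 let b_i, c_i, k_i be the linear operators acting on the i-th coordinate as the Fock operators b, c, k (b|m⟩=|m+1⟩, c|m⟩=(1−q^m)|m−1⟩, k|m⟩=q^m|m⟩) and as the identity on the other coordinates. For α = (α_1,…,α_n) ∈ ℤ_{≥0}^n define K_α = ∏_{i=1}^{n−1} k_i^{α_i^+} c_i^{α_i} with α_i^+ = α_{i+1}+…+α_n (a composition of pairwise commuting operators). Then K_{0} = id and K_α ∘ K_β = q^{φ(α,β)} K_{α+β} for all α, β ∈ ℤ_{≥0}^n, where φ(α,β) = Σ_{1≤i<j≤n} α_i β_j. -/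

import Mathlib

/-- `φ(α,β) = Σ_{1 ≤ i < j ≤ k} α_i β_j` for vectors of natural numbers. -/
def phiN {k : ℕ} (α β : Fin k → ℕ) : ℕ :=
  ∑ i, ∑ j, if i < j then α i * β j else 0

/-- The `N`-fold tensor power of the Fock space. -/
abbrev FockPow (N : ℕ) := (Fin N → ℕ) →₀ ℂ

/-- The annihilation operator `c_i` acting on the `i`-th tensor factor:
`c|m⟩ = (1−q^m)|m−1⟩`. -/
noncomputable def Cop (N : ℕ) (q : ℂ) (i : Fin N) : Module.End ℂ (FockPow N) :=
  Finsupp.lsum ℂ fun f => LinearMap.toSpanSingleton ℂ (FockPow N)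
    ((1 - q ^ f i) • Finsupp.single (Function.update f i (f i - 1)) 1)

/-- The operator `k_i` acting on the `i`-th tensor factor: `k|m⟩ = q^m|m⟩`. -/
noncomputable def Kop (N : ℕ) (q : ℂ) (i : Fin N) : Module.End ℂ (FockPow N) :=
  Finsupp.lsum ℂ fun f => LinearMap.toSpanSingleton ℂ (FockPow N)
    (q ^ f i • Finsupp.single f 1)

/-- `K_α = ∏_{i=1}^{n−1} k_i^{α_i^+} c_i^{α_i}` with `α_i^+ = α_{i+1}+…+α_n`, acting on
the `(n−1)`-fold tensor power of the Fock space (stated with `n = N+1`). -/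
noncomputable def Kmat (N : ℕ) (q : ℂ) (α : Fin (N + 1) → ℕ) : Module.End ℂ (FockPow N) :=
  (List.ofFn fun i : Fin N =>
    Kop N q i ^ (∑ j ∈ Finset.univ.filter fun j => i.castSucc < j, α j)
      * Cop N q i ^ (α i.castSucc)).prod

theorem List.prod_ofFn_mul_prod_ofFn_of_commute {R A : Type*} [CommSemiring R] [Semiring A]
    [Algebra R A] {N : ℕ} (x y z : Fin N → A) (s : Fin N → R)
    (hc : ∀ i j, i ≠ j → Commute (x i) (y j)) (h : ∀ i, x i * y i = s i • z i) :
    (List.ofFn x).prod * (List.ofFn y).prod = (∏ i, s i) • (List.ofFn z).prod := by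
  induction N with
  | zero => simp
  | succ N ih =>
    have ih' := ih (fun i => x i.succ) (fun i => y i.succ) (fun i => z i.succ)
      (fun i => s i.succ) (fun i j hij => hc _ _ (by simpa using hij)) (fun i => h _)
    have hcomm : Commute (List.ofFn fun i : Fin N => x i.succ).prod (y 0) := by
      apply Commute.list_prod_left
      intro a ha
      obtain ⟨i, rfl⟩ := (List.mem_ofFn' _ _).1 ha
      exact hc _ _ (Fin.succ_ne_zero i)
    rw [List.ofFn_succ, List.ofFn_succ, List.ofFn_succ, List.prod_cons, List.prod_cons,
      List.prod_cons, Fin.prod_univ_succ, mul_assoc, ← mul_assoc _ (y 0), hcomm.eq, mul_assoc,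
      ih', ← mul_assoc, h, smul_mul_smul_comm]

theorem Kop_single (N : ℕ) (q : ℂ) (i : Fin N) (f : Fin N → ℕ) (a : ℂ) :
    Kop N q i (Finsupp.single f a) = Finsupp.single f (a * q ^ f i) := by
  simp [Kop]

theorem Cop_single (N : ℕ) (q : ℂ) (i : Fin N) (f : Fin N → ℕ) (a : ℂ) :
    Cop N q i (Finsupp.single f a) =
      Finsupp.single (Function.update f i (f i - 1)) (a * (1 - q ^ f i)) := by
  simp only [Cop, Finsupp.lsum_single, LinearMap.toSpanSingleton_apply, Finsupp.smul_single,
    smul_eq_mul, mul_one]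

theorem Cop_mul_Kop (N : ℕ) (q : ℂ) (i : Fin N) :
    Cop N q i * Kop N q i = q • (Kop N q i * Cop N q i) := by
  refine Finsupp.lhom_ext fun f a => ?_
  simp only [Module.End.mul_apply, LinearMap.smul_apply, Kop_single, Cop_single,
    Finsupp.smul_single, Function.update_self, smul_eq_mul]
  congr 1
  rcases f i with _ | m
  · simp
  · simp only [Nat.add_sub_cancel]
    ring

theorem commute_Kop_Kop (N : ℕ) (q : ℂ) (i j : Fin N) : Commute (Kop N q i) (Kop N q j) := by
  refine Finsupp.lhom_ext fun f a => ?_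
  simp only [Module.End.mul_apply, Kop_single]
  congr 1
  ring

theorem commute_Kop_Cop (N : ℕ) (q : ℂ) {i j : Fin N} (h : i ≠ j) :
    Commute (Kop N q i) (Cop N q j) := by
  refine Finsupp.lhom_ext fun f a => ?_
  simp only [Module.End.mul_apply, Kop_single, Cop_single, Function.update_of_ne h]
  congr 1
  ring

theorem commute_Cop_Cop (N : ℕ) (q : ℂ) {i j : Fin N} (h : i ≠ j) :
    Commute (Cop N q i) (Cop N q j) := by
  refine Finsupp.lhom_ext fun f a => ?_
  simp only [Module.End.mul_apply, Cop_single, Function.update_of_ne h,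
    Function.update_of_ne h.symm]
  rw [Function.update_comm h]
  congr 1
  ring

theorem mul_pow_of_mul_eq_smul_mul {R A : Type*} [CommSemiring R] [Semiring A] [Algebra R A]
    {q : R} {c k : A} (h : c * k = q • (k * c)) (n : ℕ) :
    c * k ^ n = q ^ n • (k ^ n * c) := by
  induction n with
  | zero => simp
  | succ n ih =>
    rw [pow_succ, ← mul_assoc, ih, smul_mul_assoc, mul_assoc, h, mul_smul_comm, smul_smul,
      ← pow_succ, mul_assoc]

theorem pow_mul_pow_of_mul_eq_smul_mul {R A : Type*} [CommSemiring R] [Semiring A] [Algebra R A]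
    {q : R} {c k : A} (h : c * k = q • (k * c)) (m n : ℕ) :
    c ^ m * k ^ n = q ^ (m * n) • (k ^ n * c ^ m) := by
  induction m with
  | zero => simp
  | succ m ih =>
    rw [pow_succ, mul_assoc, mul_pow_of_mul_eq_smul_mul h, mul_smul_comm, ← mul_assoc, ih,
      smul_mul_assoc, smul_smul, mul_assoc, ← pow_add]
    congr 2
    ring

theorem phiN_eq_sum {N : ℕ} (α β : Fin (N + 1) → ℕ) :
    phiN α β =
      ∑ i : Fin N, α i.castSucc * ∑ j ∈ Finset.univ.filter fun j => i.castSucc < j, β j := by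
  have hlast : ∀ j : Fin (N + 1), ¬ Fin.last N < j := fun j => not_lt.2 (Fin.le_last j)
  simp [phiN, Fin.sum_univ_castSucc (n := N) (f := fun i => ∑ j, if i < j then α i * β j else 0),
    hlast, Finset.mul_sum, Finset.sum_filter]

/-- `K_0 = id` and `K_α K_β = q^{φ(α,β)} K_{α+β}` (stated with `n = N+1`, `N ≥ 1`,
so that `n ≥ 2`). -/
theorem Kmat_zero_and_mul (N : ℕ) (hN : 1 ≤ N) (q : ℂ) :
    Kmat N q 0 = 1 ∧
      ∀ α β : Fin (N + 1) → ℕ,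
        Kmat N q α * Kmat N q β = q ^ phiN α β • Kmat N q (α + β) := by
  refine ⟨by simp [Kmat], fun α β => ?_⟩
  rw [phiN_eq_sum, ← Finset.prod_pow_eq_pow_sum]
  refine List.prod_ofFn_mul_prod_ofFn_of_commute _ _ _ _ (fun i j hij => ?_) fun i => ?_
  · exact (((commute_Kop_Kop N q i j).pow_pow _ _).mul_right
      ((commute_Kop_Cop N q hij).pow_pow _ _)).mul_left
      (((commute_Kop_Cop N q hij.symm).symm.pow_pow _ _).mul_right
      ((commute_Cop_Cop N q hij).pow_pow _ _))
  · simp only [Pi.add_apply, Finset.sum_add_distrib, pow_add]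
    rw [mul_assoc, ← mul_assoc (Cop N q i ^ _),
      pow_mul_pow_of_mul_eq_smul_mul (Cop_mul_Kop N q i)]
    simp only [smul_mul_assoc, mul_smul_comm, mul_assoc]
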